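/- The much larger inclusion 𝐝 ⋐ 2^ℕ holds: 𝐝 ⊊ 2^ℕ and there exists a countable collection {D_j}_{j∈ℕ} ⊆ 𝐝 of nonempty pairwise disjoint subsets of ℕ such that for every infinite subset K ⊆ ℕ, the union ⋃_{k∈K} D_k belongs to 2^ℕ \ 𝐝, i.e., does not have density zero. -/

import Mathlib

open Filter

/-- The ideal `𝐟` of all finite subsets of `ℕ`. -/
def finIdeal : Set (Set ℕ) := {A : Set ℕ | A.Finite}

/-- `C ⊆ D mod 𝐟`: the set `C \ D` is finite. -/
def ModF (C D : Set ℕ) : Prop := (C \ D).Finite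

/-- The infinite arithmetic progression `a ℕ₀ + b = {a k + b : k ∈ ℕ₀}`. -/
def apSet (a b : ℕ) : Set ℕ := {m : ℕ | ∃ k : ℕ, m = a * k + b}

/-- `ℛ`: the set of all finite unions of infinite arithmetic progressions
`⋃_{i=1}^n (a_i ℕ₀ + b_i)` with `n ∈ ℕ` and `a_i, b_i ∈ ℕ = {1, 2, 3, …}`. -/
def calR : Set (Set ℕ) :=
  {B : Set ℕ | ∃ n : ℕ, ∃ a b : Fin (n + 1) → ℕ,
    (∀ i, 0 < a i) ∧ (∀ i, 0 < b i) ∧ B = ⋃ i, apSet (a i) (b i)}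

/-- The infinite tiling `(⋃_{j=0}^∞ (T + j r)) + b` of a tile `T` of length `r`. -/
def tiling (r b : ℕ) (T : Set ℕ) : Set ℕ :=
  {m : ℕ | ∃ t ∈ T, ∃ j : ℕ, m = t + j * r + b}

/-- `𝒯`: the set of all infinite tilings `(⋃_{j=0}^∞ (T + j r)) + b` with
`r, b ∈ ℕ = {1, 2, 3, …}` and `T ⊆ {0, 1, …, r - 1}` a tile of length `r`. -/
def calT : Set (Set ℕ) :=
  {A : Set ℕ | ∃ r b : ℕ, 0 < r ∧ 0 < b ∧
    ∃ T : Set ℕ, T ⊆ Set.Iio r ∧ A = tiling r b T}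

/-- `|X ∩ [1, n]|`. -/
noncomputable def cnt (X : Set ℕ) (n : ℕ) : ℕ := Nat.card ↥(X ∩ Set.Icc 1 n)

/-- `X` has density `δ`, i.e. `d(X) := lim_{n→∞} |X ∩ [1,n]| / n = δ`. -/
def HasDensity (X : Set ℕ) (δ : ℝ) : Prop :=
  Tendsto (fun n : ℕ => (cnt X n : ℝ) / n) atTop (nhds δ)

/-- The ideal `𝐝` of all subsets of `ℕ` with density zero. -/
def densIdeal : Set (Set ℕ) := {X : Set ℕ | HasDensity X 0}

/-- `|X ∩ [k+1, k+n]|`. -/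
noncomputable def cntI (X : Set ℕ) (k n : ℕ) : ℕ := Nat.card ↥(X ∩ Set.Icc (k + 1) (k + n))

/-- `max_{k ∈ ℕ₀} |X ∩ [k+1, k+n]|`. -/
noncomputable def maxCnt (X : Set ℕ) (n : ℕ) : ℕ := sSup {m : ℕ | ∃ k : ℕ, m = cntI X k n}

/-- The ideal `𝐛` of all subsets of `ℕ` with Banach density
`b(X) := lim_{n→∞} max_{k∈ℕ₀} |X ∩ [k+1, k+n]| / n` equal to zero. -/
def banachIdeal : Set (Set ℕ) :=
  {X : Set ℕ | Tendsto (fun n : ℕ => (maxCnt X n : ℝ) / n) atTop (nhds 0)}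

/-- The tile density `tile(X) := inf { d(A) : A ∈ 𝒯, X ⊆ A mod 𝐟 }`. -/
noncomputable def tileDens (X : Set ℕ) : ℝ :=
  sInf {δ : ℝ | ∃ A ∈ calT, ModF X A ∧ HasDensity A δ}

/-- The ideal `𝐭` of all subsets of `ℕ` with tile density zero. -/
def tileIdeal : Set (Set ℕ) := {X : Set ℕ | tileDens X = 0}

/-- The Buck density `buck(X) := inf { d(B) : B ∈ ℛ, X ⊆ B mod 𝐟 }`. -/
noncomputable def buckDens (X : Set ℕ) : ℝ :=
  sInf {δ : ℝ | ∃ B ∈ calR, ModF X B ∧ HasDensity B δ}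

/-- The ideal `𝐫` of all subsets of `ℕ` whose reciprocal series converges. -/
def recipIdeal : Set (Set ℕ) := {X : Set ℕ | Summable (X.indicator fun x : ℕ => (1 : ℝ) / x)}

/-- `𝐢 ⋐ 𝐣`: `𝐣` is much larger than `𝐢`, i.e. `𝐢 ⊊ 𝐣` and there is a countable
collection `{D_j}` of nonempty pairwise disjoint members of `𝐢` such that for every
infinite `K ⊆ ℕ` the union `⋃_{k∈K} D_k` lies in `𝐣 \ 𝐢`. -/
def MuchLarger (i j : Set (Set ℕ)) : Prop :=
  i ⊂ j ∧ ∃ D : ℕ → Set ℕ,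
    (∀ n, D n ∈ i) ∧ (∀ n, (D n).Nonempty) ∧
    (∀ m n, m ≠ n → Disjoint (D m) (D n)) ∧
    (∀ K : Set ℕ, K.Infinite → (⋃ k ∈ K, D k) ∈ j ∧ (⋃ k ∈ K, D k) ∉ i)

theorem cnt_le_ncard {X : Set ℕ} (hX : X.Finite) (n : ℕ) : cnt X n ≤ X.ncard := by
  rw [cnt, Nat.card_coe_set_eq]
  exact Set.ncard_le_ncard Set.inter_subset_left hX

theorem Set.Finite.mem_densIdeal {X : Set ℕ} (hX : X.Finite) : X ∈ densIdeal := by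
  refine squeeze_zero (fun n => by positivity) (fun n => ?_)
    (tendsto_const_div_atTop_nhds_zero_nat (X.ncard : ℝ))
  gcongr
  exact cnt_le_ncard hX n

theorem two_pow_le_cnt {X : Set ℕ} {k : ℕ} (h : Set.Ico (2 ^ k) (2 ^ (k + 1)) ⊆ X) :
    2 ^ k ≤ cnt X (2 ^ (k + 1)) := by
  rw [cnt, Nat.card_coe_set_eq]
  have hcard : (Set.Ico (2 ^ k) (2 ^ (k + 1))).ncard = 2 ^ k := by
    rw [← Finset.coe_Ico, Set.ncard_coe_finset, Nat.card_Ico, pow_succ]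
    lia
  rw [← hcard]
  exact Set.ncard_le_ncard
    (fun m hm => ⟨h hm, Nat.one_le_two_pow.trans hm.1, hm.2.le⟩)
    ((Set.finite_Icc _ _).subset Set.inter_subset_right)

theorem iUnion_dyadic_notMem_densIdeal {K : Set ℕ} (hK : K.Infinite) :
    (⋃ k ∈ K, Set.Ico (2 ^ k) (2 ^ (k + 1))) ∉ densIdeal := by
  intro h
  have hlim : HasDensity (⋃ k ∈ K, Set.Ico (2 ^ k) (2 ^ (k + 1))) 0 := h
  obtain ⟨N, hN⟩ := eventually_atTop.1
    (hlim.eventually_lt_const (show (0 : ℝ) < 1 / 2 by norm_num))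
  obtain ⟨k, hk, hNk⟩ := hK.exists_gt N
  have hlt := hN (2 ^ (k + 1)) (hNk.le.trans (Nat.lt_two_pow_self.le.trans
    (Nat.pow_le_pow_right two_pos k.le_succ)))
  have hle : (2 : ℝ) ^ k ≤ cnt (⋃ k ∈ K, Set.Ico (2 ^ k) (2 ^ (k + 1))) (2 ^ (k + 1)) := by
    exact_mod_cast two_pow_le_cnt
      (Set.subset_biUnion_of_mem (u := fun k : ℕ => Set.Ico (2 ^ k) (2 ^ (k + 1))) hk)
  rw [div_lt_iff₀ (by positivity)] at hlt
  push_cast at hlt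
  have hpow := pow_succ (2 : ℝ) k
  linarith

theorem disjoint_dyadic {m n : ℕ} (h : m ≠ n) :
    Disjoint (Set.Ico (2 ^ m) (2 ^ (m + 1))) (Set.Ico (2 ^ n) (2 ^ (n + 1)) : Set ℕ) := by
  refine Set.disjoint_left.2 fun x hm hn => h ?_
  rw [← Nat.log_eq_of_pow_le_of_lt_pow hm.1 hm.2, Nat.log_eq_of_pow_le_of_lt_pow hn.1 hn.2]

/-- The much larger inclusion `𝐝 ⋐ 2^ℕ`. -/
theorem dens_muchLarger_univ : MuchLarger densIdeal (Set.univ : Set (Set ℕ)) := by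
  refine ⟨Set.ssubset_univ_iff.2 fun h => ?_, fun k => Set.Ico (2 ^ k) (2 ^ (k + 1)),
    fun k => (Set.finite_Ico _ _).mem_densIdeal, fun k => ?_, fun m n => disjoint_dyadic,
    fun K hK => ⟨Set.mem_univ _, iUnion_dyadic_notMem_densIdeal hK⟩⟩
  · exact iUnion_dyadic_notMem_densIdeal Set.infinite_univ (h ▸ Set.mem_univ _)
  · exact Set.nonempty_Ico.2 (Nat.pow_lt_pow_right one_lt_two k.lt_succ_self)
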